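/- arXiv:2010.10020 — 2 statements merged into one kernel-verified Lean document; each statement's English description precedes it below -/
import Mathlib

section
/- Let B be a maximal monotone graph on ℝ with (0, 0) ∈ B. Then there exists a function j : ℝ → ℝ ∪ {+∞}, not identically +∞, which is convex and lower semicontinuous, satisfies j(0) = 0 and j ≥ 0, and whose subdifferential coincides with B: for all u, ξ ∈ ℝ, (u, ξ) ∈ B if and only if j(u) < +∞ and j(u) + ξ(v − u) ≤ j(v) for every v ∈ ℝ. -/
/-- A monotone graph on `ℝ`: `(u₁ - u₂)(ξ₁ - ξ₂) ≥ 0` for all pairs of points of the graph. -/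
def IsMonotoneGraph (B : Set (ℝ × ℝ)) : Prop :=
  ∀ q₁ ∈ B, ∀ q₂ ∈ B, 0 ≤ (q₁.1 - q₂.1) * (q₁.2 - q₂.2)

/-- A maximal monotone graph on `ℝ`: a monotone graph with no proper monotone extension. -/
def IsMaxMonotoneGraph (B : Set (ℝ × ℝ)) : Prop :=
  IsMonotoneGraph B ∧ ∀ B' : Set (ℝ × ℝ), IsMonotoneGraph B' → B ⊆ B' → B' = B

/-- Accumulated Rockafellar chains starting at `(0,0)`. -/
inductive RChain (B : Set (ℝ × ℝ)) : ℝ → ℝ → ℝ → Prop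
  | base : RChain B 0 0 0
  | step (x ξ c y η : ℝ) : RChain B x ξ c → (y, η) ∈ B → RChain B y η (c + ξ * (y - x))

/-- Values of truncated slopes at points to the left of `t`. -/
def truncSet (B : Set (ℝ × ℝ)) (M t : ℝ) : Set ℝ :=
  {r | r = -M ∨ ∃ s ξ, (s, ξ) ∈ B ∧ s ≤ t ∧ |ξ| ≤ M ∧ r = ξ}

lemma truncSet_bdd (B : Set (ℝ × ℝ)) (M t : ℝ) (hM : 0 ≤ M) : BddAbove (truncSet B M t) := by
  refine ⟨M, ?_⟩
  rintro r (rfl | ⟨s, ξ, _, _, h, rfl⟩)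
  · linarith
  · exact (abs_le.1 h).2

lemma truncSet_ne (B : Set (ℝ × ℝ)) (M t : ℝ) : (truncSet B M t).Nonempty := ⟨-M, Or.inl rfl⟩

lemma trunc_mono (B : Set (ℝ × ℝ)) (M : ℝ) (hM : 0 ≤ M) :
    Monotone (fun t => sSup (truncSet B M t)) := by
  intro a b hab
  refine csSup_le_csSup (truncSet_bdd B M b hM) (truncSet_ne B M a) ?_
  rintro r (rfl | ⟨s, ξ, h1, h2, h, rfl⟩)
  · exact Or.inl rfl
  · exact Or.inr ⟨s, r, h1, h2.trans hab, h, rfl⟩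

lemma trunc_ge (B : Set (ℝ × ℝ)) (M x ξ t : ℝ) (hM : |ξ| ≤ M) (h : (x, ξ) ∈ B) (ht : x ≤ t) :
    ξ ≤ sSup (truncSet B M t) :=
  le_csSup (truncSet_bdd B M t ((abs_nonneg _).trans hM)) (Or.inr ⟨x, ξ, h, ht, hM, rfl⟩)

lemma trunc_le (B : Set (ℝ × ℝ)) (hB : IsMonotoneGraph B) (M x ξ t : ℝ) (hM : |ξ| ≤ M)
    (h : (x, ξ) ∈ B) (ht : t < x) : sSup (truncSet B M t) ≤ ξ := by
  refine csSup_le (truncSet_ne B M t) ?_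
  rintro r (rfl | ⟨s, ξ', h1, h2, h3, rfl⟩)
  · exact (abs_le.1 hM).1
  · have := hB _ h _ h1
    simp only at this
    by_contra hc
    push Not at hc
    nlinarith [mul_pos (sub_pos.2 (h2.trans_lt ht)) (sub_pos.2 hc)]

lemma trunc_subgrad (B : Set (ℝ × ℝ)) (hB : IsMonotoneGraph B) (M x ξ y : ℝ) (hM : |ξ| ≤ M)
    (h : (x, ξ) ∈ B) :
    (∫ t in (0:ℝ)..x, sSup (truncSet B M t)) + ξ * (y - x) ≤
      ∫ t in (0:ℝ)..y, sSup (truncSet B M t) := by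
  have hM0 : 0 ≤ M := (abs_nonneg _).trans hM
  have hi : ∀ a b, IntervalIntegrable (fun t => sSup (truncSet B M t)) MeasureTheory.volume a b :=
    fun a b => (trunc_mono B M hM0).intervalIntegrable
  rw [← intervalIntegral.integral_add_adjacent_intervals (hi 0 x) (hi x y)]
  have hc : ∀ a b : ℝ, (∫ _ in a..b, ξ) = (b - a) * ξ := fun a b => by simp
  rcases le_total x y with hxy | hxy
  · have := intervalIntegral.integral_mono_on_of_le_Ioo hxy
      (intervalIntegrable_const (c := ξ)) (hi x y)
      (fun t ht => trunc_ge B M x ξ t hM h ht.1.le)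
    rw [hc] at this
    linarith
  · have := intervalIntegral.integral_mono_on_of_le_Ioo hxy (hi y x)
      (intervalIntegrable_const (c := ξ))
      (fun t ht => trunc_le B hB M x ξ t hM h ht.2)
    rw [hc] at this
    rw [intervalIntegral.integral_symm y x]
    linarith

lemma RChain.mem {B : Set (ℝ × ℝ)} (h0 : ((0 : ℝ), (0 : ℝ)) ∈ B) {x ξ c : ℝ}
    (h : RChain B x ξ c) : (x, ξ) ∈ B := by
  cases h with
  | base => exact h0
  | step _ _ _ _ _ _ h => exact h

lemma RChain.bound {B : Set (ℝ × ℝ)} (hB : IsMonotoneGraph B) (h0 : ((0 : ℝ), (0 : ℝ)) ∈ B)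
    {x ξ c : ℝ} (h : RChain B x ξ c) :
    ∃ M₀, |ξ| ≤ M₀ ∧ ∀ M, M₀ ≤ M → c ≤ ∫ t in (0:ℝ)..x, sSup (truncSet B M t) := by
  induction h with
  | base => exact ⟨0, by simp, by simp⟩
  | step x ξ c y η hc hm ih =>
    obtain ⟨M₀, h1, h2⟩ := ih
    refine ⟨max M₀ |η|, le_max_right _ _, fun M hM => ?_⟩
    have hM' := (le_max_left _ _).trans hM
    have := trunc_subgrad B hB M x ξ y (h1.trans hM') (hc.mem h0)
    linarith [h2 M hM']

lemma RChain.cyc {B : Set (ℝ × ℝ)} (hB : IsMonotoneGraph B) (h0 : ((0 : ℝ), (0 : ℝ)) ∈ B)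
    {x ξ c : ℝ} (h : RChain B x ξ c) : c + ξ * (0 - x) ≤ 0 := by
  obtain ⟨M, h1, h2⟩ := h.bound hB h0
  have := trunc_subgrad B hB M x ξ 0 h1 (h.mem h0)
  rw [intervalIntegral.integral_same] at this
  linarith [h2 M le_rfl]

/-- Rockafellar's potential. -/
noncomputable def rpot (B : Set (ℝ × ℝ)) (z : ℝ) : EReal :=
  ⨆ p : {p : ℝ × ℝ × ℝ // RChain B p.1 p.2.1 p.2.2},
    ((p.1.2.2 + p.1.2.1 * (z - p.1.1) : ℝ) : EReal)

lemma le_rpot {B : Set (ℝ × ℝ)} {x ξ c : ℝ} (h : RChain B x ξ c) (z : ℝ) :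
    ((c + ξ * (z - x) : ℝ) : EReal) ≤ rpot B z :=
  le_iSup (fun p : {p : ℝ × ℝ × ℝ // RChain B p.1 p.2.1 p.2.2} =>
    ((p.1.2.2 + p.1.2.1 * (z - p.1.1) : ℝ) : EReal)) ⟨(x, ξ, c), h⟩

lemma rpot_le {B : Set (ℝ × ℝ)} {z : ℝ} {a : EReal}
    (h : ∀ x ξ c, RChain B x ξ c → ((c + ξ * (z - x) : ℝ) : EReal) ≤ a) : rpot B z ≤ a :=
  iSup_le fun p => h _ _ _ p.2

lemma rpot_nonneg (B : Set (ℝ × ℝ)) (z : ℝ) : 0 ≤ rpot B z := by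
  simpa using le_rpot (RChain.base (B := B)) z

lemma rpot_zero {B : Set (ℝ × ℝ)} (hB : IsMonotoneGraph B) (h0 : ((0 : ℝ), (0 : ℝ)) ∈ B) :
    rpot B 0 = 0 :=
  le_antisymm (rpot_le fun _ _ _ h => by exact_mod_cast h.cyc hB h0) (rpot_nonneg B 0)

lemma rpot_fin {B : Set (ℝ × ℝ)} (hB : IsMonotoneGraph B) (h0 : ((0 : ℝ), (0 : ℝ)) ∈ B)
    {u ξ : ℝ} (h : (u, ξ) ∈ B) : rpot B u < ⊤ := by
  refine lt_of_le_of_lt (b := ((ξ * u : ℝ) : EReal)) (rpot_le fun x η c hc => ?_)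
    (EReal.coe_lt_top _)
  have := (RChain.step x η c u ξ hc h).cyc hB h0
  exact_mod_cast (by linarith : c + η * (u - x) ≤ ξ * u)

lemma rpot_sub {B : Set (ℝ × ℝ)} {u ξ : ℝ} (h : (u, ξ) ∈ B) (v : ℝ) :
    rpot B u + ((ξ * (v - u) : ℝ) : EReal) ≤ rpot B v := by
  rw [← EReal.le_sub_iff_add_le (Or.inl (EReal.coe_ne_bot _)) (Or.inl (EReal.coe_ne_top _))]
  refine rpot_le fun x η c hc => ?_
  rw [EReal.le_sub_iff_add_le (Or.inl (EReal.coe_ne_bot _)) (Or.inl (EReal.coe_ne_top _))]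
  have := le_rpot (RChain.step x η c u ξ hc h) v
  rwa [EReal.coe_add] at this

/-- Let `B` be a maximal monotone graph on `ℝ` with `(0,0) ∈ B`. Then there is
a function `j : ℝ → ℝ ∪ {+∞}` (encoded as `ℝ → EReal` never taking the value `⊥`), not
identically `+∞`, convex and lower semicontinuous, with `j(0) = 0` and `j ≥ 0`, whose
subdifferential coincides with `B`: `(u, ξ) ∈ B` iff `j u < +∞` and
`j u + ξ(v - u) ≤ j v` for all `v`. -/
theorem maxMonotone_is_subdifferential (B : Set (ℝ × ℝ)) (hB : IsMaxMonotoneGraph B)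
    (h0 : ((0 : ℝ), (0 : ℝ)) ∈ B) :
    ∃ j : ℝ → EReal,
      (∀ x : ℝ, j x ≠ ⊥) ∧
      (∃ v : ℝ, j v ≠ ⊤) ∧
      (∀ u v t : ℝ, 0 ≤ t → t ≤ 1 →
        j (t * u + (1 - t) * v) ≤ (t : EReal) * j u + ((1 - t : ℝ) : EReal) * j v) ∧
      LowerSemicontinuous j ∧
      j 0 = 0 ∧ (∀ x : ℝ, 0 ≤ j x) ∧
      (∀ u ξ : ℝ, (u, ξ) ∈ B ↔
        (j u < ⊤ ∧ ∀ v : ℝ, j u + ((ξ * (v - u) : ℝ) : EReal) ≤ j v)) := by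
  have hm := hB.1
  refine ⟨rpot B, fun x => ?_, ⟨0, ?_⟩, ?_, ?_, rpot_zero hm h0, rpot_nonneg B, ?_⟩
  · exact (lt_of_lt_of_le EReal.bot_lt_zero (rpot_nonneg B x)).ne'
  · rw [rpot_zero hm h0]; simp
  · intro u v t ht ht1
    refine rpot_le fun x ξ c hc => ?_
    have e : c + ξ * (t * u + (1 - t) * v - x)
        = t * (c + ξ * (u - x)) + (1 - t) * (c + ξ * (v - x)) := by ring
    rw [e, EReal.coe_add, EReal.coe_mul, EReal.coe_mul]
    exact add_le_add
      (mul_le_mul_of_nonneg_left (le_rpot hc u) (EReal.coe_nonneg.2 ht))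
      (mul_le_mul_of_nonneg_left (le_rpot hc v) (EReal.coe_nonneg.2 (sub_nonneg.2 ht1)))
  · refine lowerSemicontinuous_iSup fun p => Continuous.lowerSemicontinuous ?_
    exact continuous_coe_real_ereal.comp (by fun_prop)
  · have key := hB.2 {q | rpot B q.1 < ⊤ ∧
      ∀ v : ℝ, rpot B q.1 + ((q.2 * (v - q.1) : ℝ) : EReal) ≤ rpot B v} ?_ ?_
    · intro u ξ
      conv_lhs => rw [← key]
      rfl
    · rintro ⟨u, ξ⟩ ⟨hu, hu'⟩ ⟨v, η⟩ ⟨hv, hv'⟩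
      simp only at hu hu' hv hv' ⊢
      have h1 := hu' v
      have h2 := hv' u
      have bu : rpot B u ≠ ⊥ := (lt_of_lt_of_le EReal.bot_lt_zero (rpot_nonneg B u)).ne'
      have bv : rpot B v ≠ ⊥ := (lt_of_lt_of_le EReal.bot_lt_zero (rpot_nonneg B v)).ne'
      lift rpot B u to ℝ using ⟨hu.ne, bu⟩ with a
      lift rpot B v to ℝ using ⟨hv.ne, bv⟩ with b
      norm_cast at h1 h2
      nlinarith
    · rintro ⟨u, ξ⟩ h
      exact ⟨rpot_fin hm h0 h, rpot_sub h⟩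
end

section
/- Let B be a maximal monotone graph on ℝ with (0, 0) ∈ B, let (u, ξ) ∈ B, let γ : ℝ → ℝ be nondecreasing with γ(0) = 0, and let ρ : ℝ → ℝ be any function such that (ρ(σ), σ) ∈ B for every σ in the closed interval with endpoints 0 and ξ. Then the composite σ ↦ γ(ρ(σ)) is integrable on that interval and 0 ≤ ∫₀^ξ γ(ρ(σ)) dσ ≤ ξ · γ(u). -/
open MeasureTheory intervalIntegral

/-- Let `B` be maximal monotone on `ℝ` with `(0,0) ∈ B`, `(u, ξ) ∈ B`,
`γ : ℝ → ℝ` nondecreasing with `γ(0) = 0`, and `ρ : ℝ → ℝ` a selection of `B⁻¹` on the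
closed interval with endpoints `0` and `ξ` (i.e. `(ρ σ, σ) ∈ B` there). Then `γ ∘ ρ` is
integrable on that interval and `0 ≤ ∫₀^ξ γ(ρ σ) dσ ≤ ξ * γ(u)` (oriented integral). -/
theorem inverse_selection_integral_bounds (B : Set (ℝ × ℝ)) (hB : IsMaxMonotoneGraph B)
    (h0 : ((0 : ℝ), (0 : ℝ)) ∈ B) (u ξ : ℝ) (huξ : (u, ξ) ∈ B)
    (γ : ℝ → ℝ) (hγ : Monotone γ) (hγ0 : γ 0 = 0)
    (ρ : ℝ → ℝ) (hρ : ∀ σ ∈ Set.uIcc (0 : ℝ) ξ, (ρ σ, σ) ∈ B) :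
    IntervalIntegrable (fun σ => γ (ρ σ)) volume 0 ξ ∧
    0 ≤ ∫ σ in (0 : ℝ)..ξ, γ (ρ σ) ∧
    (∫ σ in (0 : ℝ)..ξ, γ (ρ σ)) ≤ ξ * γ u := by
  have key : ∀ a b x y : ℝ, (a, x) ∈ B → (b, y) ∈ B → x < y → a ≤ b := by
    intro a b x y ha hb hxy
    have h := hB.1 _ ha _ hb
    simp only at h
    by_contra hc
    push Not at hc
    nlinarith [mul_pos (sub_pos.2 hc) (sub_pos.2 hxy)]
  have hmono : MonotoneOn (fun σ => γ (ρ σ)) (Set.uIcc 0 ξ) := by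
    intro x hx y hy hxy
    rcases hxy.eq_or_lt with rfl | h
    · exact le_rfl
    · exact hγ (key _ _ _ _ (hρ x hx) (hρ y hy) h)
  have hint : IntervalIntegrable (fun σ => γ (ρ σ)) volume 0 ξ := hmono.intervalIntegrable
  refine ⟨hint, ?_⟩
  rcases le_total 0 ξ with hξ | hξ
  · have hb : ∀ x ∈ Set.Ioo 0 ξ, 0 ≤ γ (ρ x) ∧ γ (ρ x) ≤ γ u := by
      intro x hx
      have hm := hρ x (by rw [Set.uIcc_of_le hξ]; exact ⟨hx.1.le, hx.2.le⟩)
      exact ⟨hγ0 ▸ hγ (key _ _ _ _ h0 hm hx.1), hγ (key _ _ _ _ hm huξ hx.2)⟩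
    have h1 := integral_mono_on_of_le_Ioo hξ
      (intervalIntegrable_const (c := (0 : ℝ))) hint (fun x hx => (hb x hx).1)
    have h2 := integral_mono_on_of_le_Ioo hξ hint
      (intervalIntegrable_const (c := γ u)) (fun x hx => (hb x hx).2)
    simp at h1 h2
    exact ⟨h1, h2⟩
  · have hb : ∀ x ∈ Set.Ioo ξ 0, γ (ρ x) ≤ 0 ∧ γ u ≤ γ (ρ x) := by
      intro x hx
      have hm := hρ x (by rw [Set.uIcc_of_ge hξ]; exact ⟨hx.1.le, hx.2.le⟩)
      exact ⟨hγ0 ▸ hγ (key _ _ _ _ hm h0 hx.2), hγ (key _ _ _ _ huξ hm hx.1)⟩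
    have h1 := integral_mono_on_of_le_Ioo hξ hint.symm
      (intervalIntegrable_const (c := (0 : ℝ))) (fun x hx => (hb x hx).1)
    have h2 := integral_mono_on_of_le_Ioo hξ
      (intervalIntegrable_const (c := γ u)) hint.symm (fun x hx => (hb x hx).2)
    rw [integral_symm ξ 0]
    rw [intervalIntegral.integral_const, smul_eq_mul] at h1 h2
    constructor <;> linarith
end
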